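/- There exists a constant N depending only on p such that for every integer n ≥ 1, every r ∈ ℝ and every g ≥ 0: g²·φ_n''(r) ≤ N·φ_n(r) + N·g^p. -/

import Mathlib

noncomputable def phi (p : ℝ) (n : ℕ) (r : ℝ) : ℝ :=
  if |r| < n then |r| ^ p
  else (n : ℝ) ^ (p - 2) * (p * (p - 1) / 2) * (|r| - n) ^ 2
        + p * (n : ℝ) ^ (p - 1) * (|r| - n) + (n : ℝ) ^ p

open Filter Topology in
theorem hasDerivAt_ite_lt {f g f' g' : ℝ → ℝ} {a x : ℝ}
    (hf : x ≤ a → HasDerivAt f (f' x) x) (hg : a ≤ x → HasDerivAt g (g' x) x)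
    (h : f a = g a) (h' : f' a = g' a) :
    HasDerivAt (fun y => if y < a then f y else g y) (if x < a then f' x else g' x) x := by
  rcases lt_trichotomy x a with hx | rfl | hx
  · rw [if_pos hx]
    refine (hf hx.le).congr_of_eventuallyEq ?_
    filter_upwards [Iio_mem_nhds hx] with y hy
    exact if_pos hy
  · rw [if_neg (lt_irrefl x), ← hasDerivWithinAt_univ, ← Set.Iic_union_Ici (a := x)]
    refine HasDerivWithinAt.union ?_ ?_
    · rw [← h']
      refine (hf le_rfl).hasDerivWithinAt.congr (fun y hy => ?_) (by simp [h])
      rcases (Set.mem_Iic.1 hy).lt_or_eq with hy | rfl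
      · exact if_pos hy
      · simp [h]
    · exact (hg le_rfl).hasDerivWithinAt.congr (fun y hy => if_neg (not_lt.2 hy)) (by simp)
  · rw [if_neg hx.not_gt]
    refine (hg hx.le).congr_of_eventuallyEq ?_
    filter_upwards [Ioi_mem_nhds hx] with y hy
    exact if_neg (not_lt.2 (le_of_lt hy))

theorem sq_mul_rpow_sub_two_le {p g m : ℝ} (hp : 2 ≤ p) (hg : 0 ≤ g) (hm : 0 ≤ m) :
    g ^ 2 * m ^ (p - 2) ≤ m ^ p + g ^ p := by
  have key : ∀ x : ℝ, 0 ≤ x → x ^ 2 * x ^ (p - 2) = x ^ p := fun x hx => by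
    rw [← Real.rpow_two, ← Real.rpow_add_of_nonneg hx (by norm_num) (by linarith)]
    ring_nf
  have hgp := Real.rpow_nonneg hg p
  have hmp := Real.rpow_nonneg hm p
  rcases le_total g m with h | h
  · calc g ^ 2 * m ^ (p - 2) ≤ m ^ 2 * m ^ (p - 2) := by gcongr
      _ ≤ m ^ p + g ^ p := by rw [key m hm]; linarith
  · calc g ^ 2 * m ^ (p - 2) ≤ g ^ 2 * g ^ (p - 2) := by
          gcongr
      _ ≤ m ^ p + g ^ p := by rw [key g hg]; linarith

theorem phi_neg (p : ℝ) (n : ℕ) (r : ℝ) : phi p n (-r) = phi p n r := by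
  simp [phi]

theorem deriv_deriv_phi_neg (p : ℝ) (n : ℕ) (r : ℝ) :
    deriv (deriv (phi p n)) (-r) = deriv (deriv (phi p n)) r := by
  have h : ∀ x, deriv (phi p n) (-x) = -deriv (phi p n) x := fun x => by
    have := deriv_comp_neg (phi p n) x
    simp only [phi_neg] at this
    linarith
  have h2 := deriv_comp_neg (deriv (phi p n)) r
  simp only [h, deriv.fun_neg] at h2
  linarith

theorem min_rpow_le_phi {p : ℝ} (hp : 2 ≤ p) (n : ℕ) (r : ℝ) :
    min |r| n ^ p ≤ phi p n r := by
  unfold phi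
  split_ifs with h
  · rw [min_eq_left h.le]
  · rw [not_lt] at h
    rw [min_eq_right h]
    have h1 : 0 ≤ |r| - n := sub_nonneg.2 h
    have h2 : 0 ≤ p - 1 := by linarith
    have h3 : 0 ≤ p := by linarith
    have : 0 ≤ (n : ℝ) ^ (p - 2) * (p * (p - 1) / 2) * (|r| - n) ^ 2
        + p * (n : ℝ) ^ (p - 1) * (|r| - n) := by positivity
    linarith

open Filter Topology in
theorem deriv_deriv_phi_of_pos (p : ℝ) (n : ℕ) {r : ℝ} (hr : 0 < r) :
    deriv (deriv (phi p n)) r = p * (p - 1) * min r n ^ (p - 2) := by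
  have h1 : ∀ x : ℝ, 0 < x → HasDerivAt (phi p n)
      (if x < n then p * x ^ (p - 1)
        else (n : ℝ) ^ (p - 2) * (p * (p - 1)) * (x - n) + p * (n : ℝ) ^ (p - 1)) x := by
    intro x hx
    have := hasDerivAt_ite_lt (a := (n : ℝ)) (x := x) (f := fun y => y ^ p)
      (g := fun y => (n : ℝ) ^ (p - 2) * (p * (p - 1) / 2) * (y - n) ^ 2
        + p * (n : ℝ) ^ (p - 1) * (y - n) + (n : ℝ) ^ p)
      (f' := fun y => p * y ^ (p - 1))
      (g' := fun y => (n : ℝ) ^ (p - 2) * (p * (p - 1)) * (y - n) + p * (n : ℝ) ^ (p - 1))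
      (fun _ => Real.hasDerivAt_rpow_const (Or.inl hx.ne'))
      (fun _ => by
        have hd : HasDerivAt (fun y : ℝ => y - n) 1 x := (hasDerivAt_id x).sub_const _
        refine ((((hd.pow 2).const_mul ((n : ℝ) ^ (p - 2) * (p * (p - 1) / 2))).add
          (hd.const_mul (p * (n : ℝ) ^ (p - 1)))).add_const ((n : ℝ) ^ p)).congr_deriv ?_
        simp only [Nat.cast_ofNat]
        ring)
      (by simp) (by simp)
    refine this.congr_of_eventuallyEq ?_
    filter_upwards [Ioi_mem_nhds hx] with y hy
    simp only [phi, abs_of_pos (Set.mem_Ioi.1 hy)]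
  have h2 : deriv (phi p n) =ᶠ[𝓝 r] fun x => if x < n then p * x ^ (p - 1)
        else (n : ℝ) ^ (p - 2) * (p * (p - 1)) * (x - n) + p * (n : ℝ) ^ (p - 1) := by
    filter_upwards [Ioi_mem_nhds hr] with y hy
    exact (h1 y hy).deriv
  rw [h2.deriv_eq]
  have h3 := hasDerivAt_ite_lt (a := (n : ℝ)) (x := r) (f := fun y => p * y ^ (p - 1))
    (g := fun y => (n : ℝ) ^ (p - 2) * (p * (p - 1)) * (y - n) + p * (n : ℝ) ^ (p - 1))
    (f' := fun y => p * (p - 1) * y ^ (p - 2))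
    (g' := fun _ => p * (p - 1) * (n : ℝ) ^ (p - 2))
    (fun _ => by
      refine ((Real.hasDerivAt_rpow_const (p := p - 1)
        (Or.inl hr.ne')).const_mul p).congr_deriv ?_
      rw [show p - 1 - 1 = p - 2 by ring]
      ring)
    (fun _ => by
      have hd : HasDerivAt (fun y : ℝ => y - n) 1 r := (hasDerivAt_id r).sub_const _
      refine ((hd.const_mul ((n : ℝ) ^ (p - 2) * (p * (p - 1)))).add_const
        (p * (n : ℝ) ^ (p - 1))).congr_deriv ?_
      ring)
    (by simp) rfl
  rw [h3.deriv]
  split_ifs with h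
  · rw [min_eq_left h.le]
  · rw [min_eq_right (not_lt.1 h)]

open Filter Topology in
theorem deriv_deriv_phi_zero {p : ℝ} (hp : 2 ≤ p) {n : ℕ} (hn : 1 ≤ n) :
    deriv (deriv (phi p n)) 0 = p * 0 ^ (p - 2) := by
  have hn0 : (0 : ℝ) < n := by exact_mod_cast hn
  have h1 : phi p n =ᶠ[𝓝 0] fun x => |x| ^ p := by
    have : ∀ᶠ x : ℝ in 𝓝 0, |x| < n :=
      continuous_abs.continuousAt.eventually_lt continuousAt_const (by simpa using hn0)
    filter_upwards [this] with x hx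
    exact if_pos hx
  have h2 : deriv (fun x : ℝ => |x| ^ p) = fun x => p * |x| ^ (p - 2) * x :=
    funext fun x => (hasDerivAt_abs_rpow x (by linarith)).deriv
  rw [h1.deriv.deriv_eq, h2]
  refine HasDerivAt.deriv ?_
  rw [hasDerivAt_iff_tendsto_slope]
  have hc : Continuous fun x : ℝ => p * |x| ^ (p - 2) :=
    continuous_const.mul (continuous_abs.rpow_const fun _ => Or.inr (by linarith))
  have ht := (hc.tendsto 0).mono_left (nhdsWithin_le_nhds (s := {0}ᶜ))
  rw [abs_zero] at ht
  refine ht.congr' ?_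
  filter_upwards [self_mem_nhdsWithin] with x hx
  have hx : x ≠ 0 := hx
  simp only [slope_def_field]
  field_simp
  ring

theorem deriv_deriv_phi_le {p : ℝ} (hp : 2 ≤ p) {n : ℕ} (hn : 1 ≤ n) (r : ℝ) :
    deriv (deriv (phi p n)) r ≤ p * (p - 1) * min |r| n ^ (p - 2) := by
  rcases lt_trichotomy r 0 with hr | rfl | hr
  · rw [← deriv_deriv_phi_neg, deriv_deriv_phi_of_pos p n (neg_pos.2 hr), abs_of_neg hr]
  · rw [deriv_deriv_phi_zero hp hn, abs_zero, min_eq_left (Nat.cast_nonneg n)]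
    have h := Real.rpow_nonneg (le_refl (0 : ℝ)) (p - 2)
    exact mul_le_mul_of_nonneg_right (by nlinarith) h
  · rw [deriv_deriv_phi_of_pos p n hr, abs_of_pos hr]

theorem phi_noise_term_bound (p : ℝ) (hp : 2 ≤ p) :
    ∃ N : ℝ, ∀ n : ℕ, 1 ≤ n → ∀ (r : ℝ) (g : ℝ), 0 ≤ g →
      g ^ 2 * deriv (deriv (phi p n)) r ≤ N * phi p n r + N * g ^ p := by
  refine ⟨p * (p - 1), fun n hn r g hg => ?_⟩
  have hN : 0 ≤ p * (p - 1) := mul_nonneg (by linarith) (by linarith)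
  have hm : 0 ≤ min |r| (n : ℝ) := le_min (abs_nonneg r) (Nat.cast_nonneg n)
  calc g ^ 2 * deriv (deriv (phi p n)) r
      ≤ g ^ 2 * (p * (p - 1) * min |r| n ^ (p - 2)) :=
        mul_le_mul_of_nonneg_left (deriv_deriv_phi_le hp hn r) (sq_nonneg g)
    _ = p * (p - 1) * (g ^ 2 * min |r| n ^ (p - 2)) := by ring
    _ ≤ p * (p - 1) * (phi p n r + g ^ p) :=
        mul_le_mul_of_nonneg_left ((sq_mul_rpow_sub_two_le hp hg hm).trans
          (add_le_add_left (min_rpow_le_phi hp n r) _)) hN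
    _ = p * (p - 1) * phi p n r + p * (p - 1) * g ^ p := by ring
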